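/- Fix an integer r ≥ 1 and a partition A of {1,…,r}. Let S_n be a set of n independent, uniformly random points in [0,1]^r and let L = L_A(S_n) be the maximum size of a chain in S_n with respect to ≼_A. Then there exists a constant a_A > 0 (depending only on A) such that, as n → ∞, L/n^{1/r} converges in probability to a_A and E[L]/n^{1/r} converges to a_A. -/

import Mathlib

open MeasureTheory

/-- The uniform probability measure on the cube `[0,1]^r`. -/
noncomputable def unifCube (r : ℕ) : Measure (Fin r → ℝ) :=
  Measure.pi fun _ => volume.restrict (Set.Icc (0 : ℝ) 1)

/-- The law of `n` independent uniformly random points in `[0,1]^r`. -/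
noncomputable def pointsMeasure (r n : ℕ) : Measure (Fin n → Fin r → ℝ) :=
  Measure.pi fun _ : Fin n => unifCube r

/-- The partial order `≼_A` on `ℝ^r` associated to a partition `A` of
`{1,…,r}`: `x ≼_A y` iff for every part `I` of `A`,
`max {x i : i ∈ I} ≤ min {y j : j ∈ I}`. -/
def leA {r : ℕ} (A : Finpartition (Finset.univ : Finset (Fin r)))
    (x y : Fin r → ℝ) : Prop :=
  ∀ I ∈ A.parts, ∀ i ∈ I, ∀ j ∈ I, x i ≤ y j

/-- `L_A(S)` for `S` the set of points `ω 0, …, ω (n-1)`: the maximum size of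
a chain (with respect to `≼_A`) contained in `S`. -/
noncomputable def chainLen {r : ℕ} (A : Finpartition (Finset.univ : Finset (Fin r)))
    {n : ℕ} (ω : Fin n → Fin r → ℝ) : ℕ :=
  sSup {k | ∃ T : Finset (Fin r → ℝ), ↑T ⊆ Set.range ω ∧
    IsChain (leA A) ↑T ∧ T.card = k}

/-- The largest size of a subset of `J` on which the points `ω i` are pairwise related by `c`. -/
noncomputable def cliqueSize {X ι : Type*} (c : X → X → Prop) (ω : ι → X) (J : Finset ι) : ℕ :=
  open Classical in
  J.powerset.sup fun K => if (K : Set ι).Pairwise (fun i j => c (ω i) (ω j)) then K.card else 0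

section CliqueSize

variable {X Y ι κ : Type*} {c : X → X → Prop}

lemma card_le_cliqueSize {ω : ι → X} {J K : Finset ι} (h : K ⊆ J)
    (hK : (K : Set ι).Pairwise (fun i j => c (ω i) (ω j))) : K.card ≤ cliqueSize c ω J := by
  classical
  have := Finset.le_sup (f := fun K : Finset ι =>
    if (K : Set ι).Pairwise (fun i j => c (ω i) (ω j)) then K.card else 0)
    (Finset.mem_powerset.2 h)
  simp only [if_pos hK] at this
  unfold cliqueSize
  convert this

lemma exists_card_eq_cliqueSize (c : X → X → Prop) (ω : ι → X) (J : Finset ι) :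
    ∃ K ⊆ J, (K : Set ι).Pairwise (fun i j => c (ω i) (ω j)) ∧ K.card = cliqueSize c ω J := by
  classical
  obtain ⟨K, hK, h⟩ := Finset.exists_mem_eq_sup J.powerset ⟨∅, by simp⟩ fun K : Finset ι =>
    if (K : Set ι).Pairwise (fun i j => c (ω i) (ω j)) then K.card else 0
  by_cases hp : (K : Set ι).Pairwise (fun i j => c (ω i) (ω j))
  · refine ⟨K, Finset.mem_powerset.1 hK, hp, ?_⟩
    rw [if_pos hp] at h
    rw [← h]; unfold cliqueSize; congr
  · refine ⟨∅, by simp, by simp, ?_⟩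
    rw [if_neg hp] at h
    rw [Finset.card_empty, ← h]; unfold cliqueSize; congr

lemma cliqueSize_le_card (c : X → X → Prop) (ω : ι → X) (J : Finset ι) :
    cliqueSize c ω J ≤ J.card := by
  obtain ⟨K, hK, -, h⟩ := exists_card_eq_cliqueSize c ω J
  exact h ▸ Finset.card_le_card hK

lemma cliqueSize_mono (c : X → X → Prop) (ω : ι → X) {J J' : Finset ι} (h : J ⊆ J') :
    cliqueSize c ω J ≤ cliqueSize c ω J' := by
  obtain ⟨K, hK, hp, hc⟩ := exists_card_eq_cliqueSize c ω J
  exact hc ▸ card_le_cliqueSize (hK.trans h) hp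

/-- Pulling points back along an injective relation-preserving map does not increase
the clique size. -/
lemma cliqueSize_le_of_injOn {d : Y → Y → Prop} {ω : ι → X} {ω' : κ → Y} {J : Finset ι}
    {J' : Finset κ} (e : ι → κ) (he : Set.InjOn e J) (hmem : ∀ i ∈ J, e i ∈ J')
    (h : ∀ i ∈ J, ∀ j ∈ J, c (ω i) (ω j) → d (ω' (e i)) (ω' (e j))) :
    cliqueSize c ω J ≤ cliqueSize d ω' J' := by
  classical
  obtain ⟨K, hK, hp, hc⟩ := exists_card_eq_cliqueSize c ω J
  rw [← hc, ← Finset.card_image_of_injOn (he.mono (by exact_mod_cast hK))]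
  refine card_le_cliqueSize ?_ ?_
  · intro k hk
    obtain ⟨i, hi, rfl⟩ := Finset.mem_image.1 hk
    exact hmem i (hK hi)
  · intro k hk l hl hkl
    obtain ⟨i, hi, rfl⟩ := Finset.mem_image.1 (Finset.mem_coe.1 hk)
    obtain ⟨j, hj, rfl⟩ := Finset.mem_image.1 (Finset.mem_coe.1 hl)
    exact h i (hK hi) j (hK hj) (hp hi hj fun hij => hkl (hij ▸ rfl))

lemma cliqueSize_congr {ω ω' : ι → X} {J : Finset ι} (h : ∀ i ∈ J, ω i = ω' i) :
    cliqueSize c ω J = cliqueSize c ω' J :=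
  le_antisymm
    (cliqueSize_le_of_injOn id (Set.injOn_id _) (fun _ h => h)
      fun i hi j hj hc => by simpa [h i hi, h j hj] using hc)
    (cliqueSize_le_of_injOn id (Set.injOn_id _) (fun _ h => h)
      fun i hi j hj hc => by simpa [h i hi, h j hj] using hc)

/-- Deleting a point changes the clique size only if the point lies in every largest clique. -/
lemma sum_sq_cliqueSize_sub_erase_le [Fintype ι] [DecidableEq ι] (c : X → X → Prop) (ω : ι → X) :
    ∑ i, ((cliqueSize c ω Finset.univ : ℝ) - cliqueSize c ω (Finset.univ.erase i)) ^ 2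
      ≤ cliqueSize c ω Finset.univ := by
  obtain ⟨K, -, hp, hc⟩ := exists_card_eq_cliqueSize c ω Finset.univ
  have key : ∀ i, ((cliqueSize c ω Finset.univ : ℝ) - cliqueSize c ω (Finset.univ.erase i)) ^ 2
      ≤ if i ∈ K then 1 else 0 := by
    intro i
    have hle := cliqueSize_mono c ω (Finset.erase_subset i Finset.univ)
    have hge : (K.erase i).card ≤ cliqueSize c ω (Finset.univ.erase i) :=
      card_le_cliqueSize (Finset.erase_subset_erase _ (Finset.subset_univ _))
        (hp.mono (by exact_mod_cast Finset.erase_subset i K))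
    split_ifs with hi
    · have := Finset.card_erase_add_one hi
      have h1 : (cliqueSize c ω Finset.univ : ℝ) ≤ cliqueSize c ω (Finset.univ.erase i) + 1 := by
        exact_mod_cast (by omega :
          cliqueSize c ω Finset.univ ≤ cliqueSize c ω (Finset.univ.erase i) + 1)
      have h2 : (cliqueSize c ω (Finset.univ.erase i) : ℝ) ≤ cliqueSize c ω Finset.univ := by
        exact_mod_cast hle
      nlinarith
    · rw [Finset.erase_eq_of_notMem hi, hc] at hge
      rw [le_antisymm hge hle]; simp
  refine (Finset.sum_le_sum fun i _ => key i).trans ?_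
  simp [← hc]

/-- Cliques in pairwise completely related blocks can be concatenated. -/
lemma sum_cliqueSize_le [Fintype ι] [Fintype κ] (ω : ι → X) (J : κ → Finset ι)
    (hdisj : Pairwise fun a b => Disjoint (J a) (J b))
    (hc : Pairwise fun a b => ∀ i ∈ J a, ∀ j ∈ J b, c (ω i) (ω j)) :
    ∑ a, cliqueSize c ω (J a) ≤ cliqueSize c ω Finset.univ := by
  classical
  choose K hK hp hcard using fun a => exists_card_eq_cliqueSize c ω (J a)
  simp_rw [← hcard]
  rw [← Finset.card_biUnion fun a _ b _ hab => (hdisj hab).mono (hK a) (hK b)]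
  refine card_le_cliqueSize (Finset.subset_univ _) ?_
  intro i hi j hj hij
  simp only [Finset.coe_biUnion, Set.mem_iUnion, Finset.mem_coe] at hi hj
  obtain ⟨a, -, hi⟩ := hi
  obtain ⟨b, -, hj⟩ := hj
  by_cases hab : a = b
  · subst hab; exact hp a hi hj hij
  · exact hc hab i (hK a hi) j (hK b hj)

lemma measurable_cliqueSize [Countable ι] [MeasurableSpace X]
    (hc : MeasurableSet {p : X × X | c p.1 p.2}) (J : Finset ι) :
    Measurable fun ω : ι → X => cliqueSize c ω J := by
  classical
  unfold cliqueSize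
  induction J.powerset using Finset.induction_on with
  | empty => simp
  | insert K s _ ih =>
  simp only [Finset.sup_insert]
  refine Measurable.sup ?_ ih
  refine Measurable.ite ?_ measurable_const measurable_const
  have : {ω : ι → X | (K : Set ι).Pairwise fun i j => c (ω i) (ω j)}
      = ⋂ i ∈ (K : Set ι), ⋂ j ∈ (K : Set ι), ⋂ (_ : i ≠ j),
        (fun ω : ι → X => (ω i, ω j)) ⁻¹' {p : X × X | c p.1 p.2} := by
    ext ω; simp [Set.Pairwise]
  rw [this]
  refine MeasurableSet.biInter (Set.to_countable _) fun i _ =>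
    MeasurableSet.biInter (Set.to_countable _) fun j _ => MeasurableSet.iInter fun _ => ?_
  exact ((measurable_pi_apply i).prodMk (measurable_pi_apply j)) hc

end CliqueSize

section EfronStein

variable {X Y : Type*} [MeasurableSpace X] [MeasurableSpace Y]

lemma integrable_of_measurable_of_abs_le {μ : Measure X} [IsFiniteMeasure μ] {f : X → ℝ}
    (hf : Measurable f) {C : ℝ} (hC : ∀ x, |f x| ≤ C) : Integrable f μ :=
  Integrable.of_bound hf.aestronglyMeasurable C (ae_of_all _ fun x => by simpa using hC x)

lemma abs_integral_le_of_abs_le {μ : Measure X} [IsProbabilityMeasure μ] {f : X → ℝ} {C : ℝ}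
    (hC : ∀ x, |f x| ≤ C) : |∫ x, f x ∂μ| ≤ C := by
  simpa using norm_integral_le_of_norm_le_const (μ := μ) (f := f) (C := C)
    (ae_of_all _ fun x => by simpa using hC x)

lemma integral_sq_sub_sq_integral_le {μ : Measure X} [IsProbabilityMeasure μ] {f : X → ℝ}
    (hf : Measurable f) {C : ℝ} (hC : ∀ x, |f x| ≤ C) (a : ℝ) :
    ∫ x, f x ^ 2 ∂μ - (∫ x, f x ∂μ) ^ 2 ≤ ∫ x, (f x - a) ^ 2 ∂μ := by
  have i1 : Integrable f μ := integrable_of_measurable_of_abs_le hf hC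
  have i2 : Integrable (fun x => f x ^ 2) μ :=
    integrable_of_measurable_of_abs_le (hf.pow_const 2) (C := C ^ 2) fun x => by
      rw [abs_pow]; exact pow_le_pow_left₀ (abs_nonneg _) (hC x) 2
  have : ∫ x, (f x - a) ^ 2 ∂μ = ∫ x, f x ^ 2 ∂μ - 2 * a * ∫ x, f x ∂μ + a ^ 2 := by
    have : ∀ x, (f x - a) ^ 2 = f x ^ 2 - 2 * a * f x + a ^ 2 := fun x => by ring
    simp_rw [this]
    rw [integral_add (by fun_prop) (by fun_prop), integral_sub i2 (i1.const_mul _),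
      integral_const_mul]
    simp
  rw [this]
  nlinarith [sq_nonneg (∫ x, f x ∂μ - a)]

lemma integral_sq_sub_sub_add_expand_nonneg {μ : Measure X} [IsProbabilityMeasure μ]
    {f h q : X → ℝ} {m : ℝ} (ff : Integrable (fun p => f p * f p) μ)
    (hh : Integrable (fun p => h p * h p) μ) (qq : Integrable (fun p => q p * q p) μ)
    (fh : Integrable (fun p => f p * h p) μ) (fq : Integrable (fun p => f p * q p) μ)
    (hq : Integrable (fun p => h p * q p) μ) (fi : Integrable f μ) (hi : Integrable h μ)
    (qi : Integrable q μ) :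
    0 ≤ ∫ p, f p * f p ∂μ + ∫ p, h p * h p ∂μ + ∫ p, q p * q p ∂μ
        + (-2) * ∫ p, f p * h p ∂μ + (-2) * ∫ p, f p * q p ∂μ + 2 * ∫ p, h p * q p ∂μ
        + (2 * m) * ∫ p, f p ∂μ + (-(2 * m)) * ∫ p, h p ∂μ + (-(2 * m)) * ∫ p, q p ∂μ
        + m ^ 2 := by
  have nonneg : 0 ≤ ∫ p, (f p - h p - q p + m) ^ 2 ∂μ := integral_nonneg fun p => sq_nonneg _
  have : ∀ p, (f p - h p - q p + m) ^ 2 =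
      f p * f p + h p * h p + q p * q p + (-2) * (f p * h p) + (-2) * (f p * q p)
        + 2 * (h p * q p) + (2 * m) * f p + (-(2 * m)) * h p + (-(2 * m)) * q p + m ^ 2 :=
    fun p => by ring
  simp_rw [this] at nonneg
  rw [integral_add (by fun_prop) (by fun_prop), integral_add (by fun_prop) (by fun_prop),
    integral_add (by fun_prop) (by fun_prop), integral_add (by fun_prop) (by fun_prop),
    integral_add (by fun_prop) (by fun_prop), integral_add (by fun_prop) (by fun_prop),
    integral_add (by fun_prop) (by fun_prop), integral_add (by fun_prop) (by fun_prop),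
    integral_add (by fun_prop) (by fun_prop)] at nonneg
  simpa only [integral_const_mul, integral_const, probReal_univ, one_smul] using nonneg

/-- Subadditivity of the variance over the two factors of a product space. -/
lemma integral_sq_marginals_le {μ : Measure X} {ν : Measure Y} [IsProbabilityMeasure μ]
    [IsProbabilityMeasure ν] {f : X × Y → ℝ} (hf : Measurable f) {C : ℝ} (hC : ∀ p, |f p| ≤ C) :
    ∫ x, (∫ y, f (x, y) ∂ν) ^ 2 ∂μ + ∫ y, (∫ x, f (x, y) ∂μ) ^ 2 ∂ν
      ≤ ∫ p, f p ^ 2 ∂(μ.prod ν) + (∫ p, f p ∂(μ.prod ν)) ^ 2 := by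
  set h : X → ℝ := fun x => ∫ y, f (x, y) ∂ν with hh
  set q : Y → ℝ := fun y => ∫ x, f (x, y) ∂μ with hq
  set m : ℝ := ∫ p, f p ∂(μ.prod ν) with hm
  change ∫ x, h x ^ 2 ∂μ + ∫ y, q y ^ 2 ∂ν ≤ ∫ p, f p ^ 2 ∂(μ.prod ν) + m ^ 2
  have hhm : Measurable h := (StronglyMeasurable.integral_prod_right' (ν := ν) hf.stronglyMeasurable).measurable
  have hqm : Measurable q := (StronglyMeasurable.integral_prod_left' (μ := μ) hf.stronglyMeasurable).measurable
  have hhC : ∀ x, |h x| ≤ C := fun x => abs_integral_le_of_abs_le fun y => hC _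
  have hqC : ∀ y, |q y| ≤ C := fun y => abs_integral_le_of_abs_le fun x => hC _
  have bmul : ∀ {u v : ℝ}, |u| ≤ C → |v| ≤ C → |u * v| ≤ C * C := fun hu hv => by
    rw [abs_mul]; exact mul_le_mul hu hv (abs_nonneg _) ((abs_nonneg _).trans hu)
  have int : ∀ {u v : X × Y → ℝ}, Measurable u → Measurable v → (∀ p, |u p| ≤ C) →
      (∀ p, |v p| ≤ C) → Integrable (fun p => u p * v p) (μ.prod ν) :=
    fun hu hv hu' hv' => integrable_of_measurable_of_abs_le (hu.mul hv)
      fun p => bmul (hu' p) (hv' p)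
  have h1m : Measurable fun p : X × Y => h p.1 := hhm.comp measurable_fst
  have q1m : Measurable fun p : X × Y => q p.2 := hqm.comp measurable_snd
  have h1C : ∀ p : X × Y, |h p.1| ≤ C := fun p => hhC _
  have q1C : ∀ p : X × Y, |q p.2| ≤ C := fun p => hqC _
  have fi : Integrable f (μ.prod ν) := integrable_of_measurable_of_abs_le hf hC
  have h1i : Integrable (fun p : X × Y => h p.1) (μ.prod ν) :=
    integrable_of_measurable_of_abs_le h1m h1C
  have q1i : Integrable (fun p : X × Y => q p.2) (μ.prod ν) :=
    integrable_of_measurable_of_abs_le q1m q1C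
  have eh : ∫ p, h p.1 ∂(μ.prod ν) = m := by
    rw [integral_fun_fst]; simp [hh, hm, integral_prod _ fi]
  have eq : ∫ p, q p.2 ∂(μ.prod ν) = m := by
    rw [integral_fun_snd]; simp [hq, hm, integral_prod_symm _ fi]
  have ehh : ∫ p, h p.1 * h p.1 ∂(μ.prod ν) = ∫ x, h x ^ 2 ∂μ := by
    rw [integral_fun_fst (fun x => h x * h x)]; simp [sq]
  have eqq : ∫ p, q p.2 * q p.2 ∂(μ.prod ν) = ∫ y, q y ^ 2 ∂ν := by
    rw [integral_fun_snd (fun x => q x * q x)]; simp [sq]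
  have ehq : ∫ p, h p.1 * q p.2 ∂(μ.prod ν) = m * m := by
    rw [integral_prod_mul]
    rw [integral_fun_fst] at eh
    rw [integral_fun_snd] at eq
    simp only [probReal_univ, one_smul] at eh eq
    rw [eh, eq]
  have efh : ∫ p, f p * h p.1 ∂(μ.prod ν) = ∫ x, h x ^ 2 ∂μ := by
    rw [integral_prod _ (int hf h1m hC h1C)]
    refine integral_congr_ae (ae_of_all _ fun x => ?_)
    simp only [integral_mul_const, sq]
    rfl
  have efq : ∫ p, f p * q p.2 ∂(μ.prod ν) = ∫ y, q y ^ 2 ∂ν := by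
    rw [integral_prod_symm _ (int hf q1m hC q1C)]
    refine integral_congr_ae (ae_of_all _ fun x => ?_)
    simp only [integral_mul_const, sq]
    rfl
  have ff := int hf hf hC hC
  have hhi := int h1m h1m h1C h1C
  have qqi := int q1m q1m q1C q1C
  have fhi := int hf h1m hC h1C
  have fqi := int hf q1m hC q1C
  have hqi := int h1m q1m h1C q1C
  have key := integral_sq_sub_sub_add_expand_nonneg (m := m) ff hhi qqi fhi fqi hqi fi h1i q1i
  rw [ehh, eqq, efh, efq, ehq, eh, eq, ← hm] at key
  have e2 : ∫ p, f p ^ 2 ∂(μ.prod ν) = ∫ p, f p * f p ∂(μ.prod ν) := by simp_rw [sq]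
  rw [e2]
  linarith

/-- The Efron–Stein inequality for bounded functions of i.i.d. variables. -/
theorem efron_stein (μ : Measure X) [IsProbabilityMeasure μ] (n : ℕ) (f : (Fin n → X) → ℝ)
    (hf : Measurable f) (C : ℝ) (hC : ∀ ω, |f ω| ≤ C) (g : Fin n → (Fin n → X) → ℝ)
    (hg : ∀ i, Measurable (g i)) (hgC : ∀ i ω, |g i ω| ≤ C)
    (hgi : ∀ i ω ω', (∀ j, j ≠ i → ω j = ω' j) → g i ω = g i ω') :
    ∫ ω, f ω ^ 2 ∂(Measure.pi fun _ => μ) - (∫ ω, f ω ∂(Measure.pi fun _ => μ)) ^ 2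
      ≤ ∑ i, ∫ ω, (f ω - g i ω) ^ 2 ∂(Measure.pi fun _ => μ) := by
  induction n with
  | zero =>
    have : ∀ ω, f ω = f default := fun ω => congrArg f (Subsingleton.elim _ _)
    simp_rw [this]
    simp
  | succ n ih =>
    set P : Measure (Fin n → X) := Measure.pi fun _ => μ with hP
    have mp := (measurePreserving_piFinSuccAbove (fun _ : Fin (n + 1) => μ) 0).symm
    have transfer : ∀ F : (Fin (n + 1) → X) → ℝ, ∫ ω, F ω ∂(Measure.pi fun _ => μ)
        = ∫ p, F (Fin.cons p.1 p.2) ∂(μ.prod P) := by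
      intro F
      rw [← mp.integral_comp']
      exact integral_congr_ae (ae_of_all _ fun p => congrArg F (Fin.insertNth_zero' p.1 p.2))
    have mcons : Measurable fun p : X × (Fin n → X) => (Fin.cons p.1 p.2 : Fin (n + 1) → X) :=
      measurable_pi_iff.2 <| Fin.cases measurable_fst fun i =>
        (measurable_pi_apply i).comp measurable_snd
    have mconsr : ∀ x : X, Measurable fun y : Fin n → X => (Fin.cons x y : Fin (n + 1) → X) :=
      fun x => mcons.comp measurable_prodMk_left
    have mconsl : ∀ y : Fin n → X, Measurable fun x : X => (Fin.cons x y : Fin (n + 1) → X) :=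
      fun y => mcons.comp measurable_prodMk_right
    have bsq : ∀ {u : ℝ}, |u| ≤ C → |u ^ 2| ≤ C ^ 2 := fun hu => by
      rw [abs_pow]; exact pow_le_pow_left₀ (abs_nonneg _) hu 2
    have bsub : ∀ {u v : ℝ}, |u| ≤ C → |v| ≤ C → |(u - v) ^ 2| ≤ (C + C) ^ 2 := fun hu hv => by
      rw [abs_pow]
      exact pow_le_pow_left₀ (abs_nonneg _) ((abs_sub _ _).trans (add_le_add hu hv)) 2
    have hF : Measurable fun p : X × (Fin n → X) => f (Fin.cons p.1 p.2) := hf.comp mcons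
    have hF2i : Integrable (fun p : X × (Fin n → X) => f (Fin.cons p.1 p.2) ^ 2) (μ.prod P) :=
      integrable_of_measurable_of_abs_le (hF.pow_const 2) fun p => bsq (hC _)
    have hgsi : ∀ i, Integrable (fun p : X × (Fin n → X) =>
        (f (Fin.cons p.1 p.2) - g i (Fin.cons p.1 p.2)) ^ 2) (μ.prod P) := fun i =>
      integrable_of_measurable_of_abs_le ((hF.sub ((hg i).comp mcons)).pow_const 2)
        fun p => bsub (hC _) (hgC _ _)
    have main := integral_sq_marginals_le (μ := μ) (ν := P) hF fun p => hC _
    have first : ∫ p, f (Fin.cons p.1 p.2) ^ 2 ∂(μ.prod P)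
        - ∫ x, (∫ y, f (Fin.cons x y) ∂P) ^ 2 ∂μ
        ≤ ∑ i : Fin n, ∫ p, (f (Fin.cons p.1 p.2) - g i.succ (Fin.cons p.1 p.2)) ^ 2
            ∂(μ.prod P) := by
      rw [integral_prod _ hF2i]
      simp_rw [integral_prod _ (hgsi _)]
      rw [← integral_sub hF2i.integral_prod_left, ← integral_finsetSum]
      · refine integral_mono (hF2i.integral_prod_left.sub ?_) ?_ fun x => ?_
        · exact integrable_of_measurable_of_abs_le
            ((StronglyMeasurable.integral_prod_right' (ν := P) hF.stronglyMeasurable).measurable.pow_const 2)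
            fun x => bsq (abs_integral_le_of_abs_le fun y => hC _)
        · exact integrable_finsetSum _ fun i _ => (hgsi i.succ).integral_prod_left
        · refine ih (fun y => f (Fin.cons x y)) (hf.comp (mconsr x)) (fun y => hC _)
            (fun i y => g i.succ (Fin.cons x y)) (fun i => (hg _).comp (mconsr x))
            (fun i y => hgC _ _) fun i y y' h => hgi _ _ _ fun j hj => ?_
          refine Fin.cases (fun _ => rfl) (fun j hj => ?_) j hj
          exact h j fun hji => hj (by rw [hji])
      · exact fun i _ => (hgsi i.succ).integral_prod_left
      · exact integrable_of_measurable_of_abs_le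
            ((StronglyMeasurable.integral_prod_right' (ν := P) hF.stronglyMeasurable).measurable.pow_const 2)
            fun x => bsq (abs_integral_le_of_abs_le fun y => hC _)
    have second : ∫ p, f (Fin.cons p.1 p.2) ^ 2 ∂(μ.prod P)
        - ∫ y, (∫ x, f (Fin.cons x y) ∂μ) ^ 2 ∂P
        ≤ ∫ p, (f (Fin.cons p.1 p.2) - g 0 (Fin.cons p.1 p.2)) ^ 2 ∂(μ.prod P) := by
      rw [integral_prod_symm _ hF2i, integral_prod_symm _ (hgsi 0)]
      have hi : Integrable (fun y => (∫ x, f (Fin.cons x y) ∂μ) ^ 2) P :=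
        integrable_of_measurable_of_abs_le
            ((StronglyMeasurable.integral_prod_left' (μ := μ) hF.stronglyMeasurable).measurable.pow_const 2)
            fun x => bsq (abs_integral_le_of_abs_le fun y => hC _)
      rw [← integral_sub hF2i.integral_prod_right hi]
      refine integral_mono (hF2i.integral_prod_right.sub hi) (hgsi 0).integral_prod_right
        fun y => ?_
      obtain ⟨x₀⟩ : Nonempty X := nonempty_of_isProbabilityMeasure μ
      have : ∀ x, g 0 (Fin.cons x y) = g 0 (Fin.cons x₀ y) := fun x => hgi _ _ _ fun j hj => by
        refine Fin.cases (fun h => absurd rfl h) (fun j _ => rfl) j hj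
      simp_rw [this]
      exact integral_sq_sub_sq_integral_le (hf.comp (mconsl y)) (fun x => hC _) _
    simp_rw [transfer]
    rw [Fin.sum_univ_succ]
    linarith

end EfronStein

section Blocks

variable {X ι κ : Type*} [MeasurableSpace X] [Fintype ι] [Fintype κ]

lemma map_pi_comp_of_injective (μ : Measure X) [IsProbabilityMeasure μ] {e : κ → ι}
    (he : Function.Injective e) :
    (Measure.pi fun _ : ι => μ).map (fun ω k => ω (e k)) = Measure.pi fun _ : κ => μ := by
  have h := (ProbabilityTheory.iIndepFun_pi (μ := fun _ : ι => μ) (X := fun _ => id)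
    fun _ => aemeasurable_id).precomp he
  have h2 := (ProbabilityTheory.iIndepFun_iff_map_fun_eq_pi_map
    fun k => (measurable_pi_apply (e k)).aemeasurable).1 h
  refine h2.trans ?_
  congr 1
  funext k
  exact (measurePreserving_eval (fun _ : ι => μ) (e k)).map_eq

lemma pi_const_smul (μ : Measure X) [IsProbabilityMeasure μ] (p : ENNReal) (hp : p ≠ ⊤) :
    (Measure.pi fun _ : ι => p • μ) = p ^ Fintype.card ι • Measure.pi fun _ : ι => μ := by
  have : IsFiniteMeasure (p • μ) := Measure.smul_finite μ hp
  refine Measure.pi_eq fun s _ => ?_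
  simp [Finset.prod_mul_distrib]

/-- The mean clique size of `n` i.i.d. points with law `μ`. -/
noncomputable def meanCliqueSize (μ : Measure X) (c : X → X → Prop) (n : ℕ) : ENNReal :=
  ∫⁻ ω, (cliqueSize c ω Finset.univ : ENNReal) ∂(Measure.pi fun _ : Fin n => μ)

variable {μ : Measure X} [IsProbabilityMeasure μ] {c : X → X → Prop}

lemma measurable_cliqueSize_ennreal (hc : MeasurableSet {p : X × X | c p.1 p.2}) (J : Finset ι) :
    Measurable fun ω : ι → X => (cliqueSize c ω J : ENNReal) :=
  (measurable_of_countable _).comp (measurable_cliqueSize hc J)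

lemma meanCliqueSize_le_lintegral (hc : MeasurableSet {p : X × X | c p.1 p.2}) {m : ℕ}
    (hm : m ≤ Fintype.card ι) :
    meanCliqueSize μ c m
      ≤ ∫⁻ ω, (cliqueSize c ω Finset.univ : ENNReal) ∂(Measure.pi fun _ : ι => μ) := by
  obtain ⟨e⟩ := Function.Embedding.nonempty_of_card_le
    (α := Fin m) (β := ι) (by simpa using hm)
  rw [meanCliqueSize, ← map_pi_comp_of_injective μ e.injective,
    lintegral_map (measurable_cliqueSize_ennreal hc _) (by fun_prop)]
  refine lintegral_mono fun ω => ?_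
  refine Nat.cast_le.2 <| cliqueSize_le_of_injOn e e.injective.injOn (fun _ _ => Finset.mem_univ _)
    fun _ _ _ _ h => h

/-- Conditionally on exactly the points with index in `J` falling into the block `Q`, those points
form a scaled copy of an i.i.d. sample. -/
lemma meanCliqueSize_mul_le_setLIntegral (hc : MeasurableSet {p : X × X | c p.1 p.2})
    {Q : Set X} {φ : X → X} (hφ : Measurable φ) {p : ENNReal} (hp : p ≠ ⊤)
    (hμ : μ.restrict Q = p • μ.map φ) (hcφ : ∀ x y, c x y → c (φ x) (φ y))
    [DecidableEq ι] {J : Finset ι} {m : ℕ} (hm : m ≤ J.card) :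
    meanCliqueSize μ c m
        * (Measure.pi fun _ : ι => μ) (Set.univ.pi fun i => if i ∈ J then Q else Qᶜ)
      ≤ ∫⁻ ω in Set.univ.pi fun i => if i ∈ J then Q else Qᶜ,
          (cliqueSize c ω J : ENNReal) ∂(Measure.pi fun _ : ι => μ) := by
  set ν : ι → Measure X := fun i => μ.restrict (if i ∈ J then Q else Qᶜ) with hν
  have hr : (Measure.pi fun _ : ι => μ).restrict (Set.univ.pi fun i => if i ∈ J then Q else Qᶜ)
      = Measure.pi ν := Measure.restrict_pi_pi _ _
  set R := (Measure.pi fun i : {i // i ∉ J} => ν i) Set.univ with hR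
  have hprob : IsProbabilityMeasure (μ.map φ) := Measure.isProbabilityMeasure_map hφ.aemeasurable
  have hνJ : (Measure.pi fun i : {i // i ∈ J} => ν i)
      = p ^ Fintype.card {i // i ∈ J} •
        (Measure.pi fun _ : {i // i ∈ J} => μ).map fun u i => φ (u i) := by
    have : (fun i : {i // i ∈ J} => ν i) = fun _ => p • μ.map φ := by
      funext i; simp only [hν, if_pos i.2, hμ]
    rw [this, pi_const_smul _ _ hp, Measure.pi_map_pi fun _ => hφ.aemeasurable]
  have mp : MeasurePreserving (MeasurableEquiv.piEquivPiSubtypeProd (fun _ => X) (· ∈ J))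
      (Measure.pi ν) ((Measure.pi fun i : {i // i ∈ J} => ν i).prod
        (Measure.pi fun i : {i // i ∉ J} => ν i)) := by
    convert measurePreserving_piEquivPiSubtypeProd ν (· ∈ J)
  have key : ∀ G : ({i // i ∈ J} → X) → ENNReal, Measurable G →
      ∫⁻ ω, G (fun i => ω i) ∂(Measure.pi ν)
        = p ^ Fintype.card {i // i ∈ J} *
          (∫⁻ u, G (fun i => φ (u i)) ∂(Measure.pi fun _ : {i // i ∈ J} => μ)) * R := by
    intro G hG
    have := mp.lintegral_comp (f := fun q => G q.1) (hG.comp measurable_fst)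
    have h2 : ∫⁻ ω, G (fun i => ω i) ∂(Measure.pi ν)
        = ∫⁻ q, G q.1 ∂((Measure.pi fun i : {i // i ∈ J} => ν i).prod
            (Measure.pi fun i : {i // i ∉ J} => ν i)) := this
    rw [h2, lintegral_prod (fun q => G q.1) (hG.comp measurable_fst).aemeasurable]
    simp only [lintegral_const]
    rw [lintegral_mul_const _ hG, hνJ, lintegral_smul_measure, lintegral_map hG (by fun_prop)]
    rfl
  have hone : (Measure.pi fun _ : ι => μ) (Set.univ.pi fun i => if i ∈ J then Q else Qᶜ)
      = p ^ Fintype.card {i // i ∈ J} * R := by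
    have := key (fun _ => 1) measurable_const
    simp only [lintegral_const, one_mul, measure_univ, mul_one] at this
    rw [← this, ← hr, Measure.restrict_apply_univ]
  rw [hone, hr]
  have hcl : ∀ ω : ι → X, cliqueSize c ω J
      ≥ cliqueSize c (fun i : {i // i ∈ J} => ω i) Finset.univ := fun ω =>
    cliqueSize_le_of_injOn (fun i => i.1) Subtype.val_injective.injOn (fun i _ => i.2)
      fun _ _ _ _ h => h
  calc meanCliqueSize μ c m * (p ^ Fintype.card {i // i ∈ J} * R)
      = p ^ Fintype.card {i // i ∈ J} * meanCliqueSize μ c m * R := by ring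
    _ ≤ p ^ Fintype.card {i // i ∈ J} *
          (∫⁻ u, (cliqueSize c (fun i => φ (u i)) Finset.univ : ENNReal)
            ∂(Measure.pi fun _ : {i // i ∈ J} => μ)) * R := by
        gcongr
        refine (meanCliqueSize_le_lintegral (ι := {i // i ∈ J}) hc (by simpa using hm)).trans ?_
        refine lintegral_mono fun u => ?_
        refine Nat.cast_le.2 <| cliqueSize_le_of_injOn id (Set.injOn_id _) (fun _ h => h)
          fun i _ j _ h => hcφ _ _ h
    _ = ∫⁻ ω, (cliqueSize c (fun i : {i // i ∈ J} => ω i) Finset.univ : ENNReal)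
          ∂(Measure.pi ν) :=
        (key (fun u => (cliqueSize c u Finset.univ : ENNReal))
          (measurable_cliqueSize_ennreal hc _)).symm
    _ ≤ _ := lintegral_mono fun ω => Nat.cast_le.2 (hcl ω)

open Classical in
/-- The number of sample points in a block is at least `m` with high probability, and then the
sample inside the block has mean clique size at least that of `m` points. -/
lemma meanCliqueSize_mul_measure_le (hc : MeasurableSet {p : X × X | c p.1 p.2})
    {Q : Set X} (hQ : MeasurableSet Q) {φ : X → X} (hφ : Measurable φ) {p : ENNReal} (hp : p ≠ ⊤)
    (hμ : μ.restrict Q = p • μ.map φ) (hcφ : ∀ x y, c x y → c (φ x) (φ y)) (m : ℕ) :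
    meanCliqueSize μ c m * (Measure.pi fun _ : ι => μ)
        {ω | m ≤ (Finset.univ.filter fun i => ω i ∈ Q).card}
      ≤ ∫⁻ ω, (cliqueSize c ω (Finset.univ.filter fun i => ω i ∈ Q) : ENNReal)
          ∂(Measure.pi fun _ : ι => μ) := by
  set E : Finset ι → Set (ι → X) := fun J => Set.univ.pi fun i => if i ∈ J then Q else Qᶜ with hE
  have hmem : ∀ J ω, ω ∈ E J ↔ (Finset.univ.filter fun i => ω i ∈ Q) = J := by
    intro J ω
    simp only [hE, Set.mem_univ_pi, Finset.ext_iff, Finset.mem_filter, Finset.mem_univ, true_and]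
    refine forall_congr' fun i => ?_
    by_cases h : i ∈ J <;> simp [h]
  have hEm : ∀ J, MeasurableSet (E J) := fun J =>
    MeasurableSet.univ_pi fun i => by split_ifs <;> [exact hQ; exact hQ.compl]
  set F : Finset (Finset ι) := Finset.univ.filter fun J => m ≤ J.card with hF
  have hset : {ω : ι → X | m ≤ (Finset.univ.filter fun i => ω i ∈ Q).card} = ⋃ J ∈ F, E J := by
    ext ω
    simp [hF, hmem]
  have hdisj : (F : Set (Finset ι)).PairwiseDisjoint E := by
    intro J _ J' _ hJ
    refine Set.disjoint_left.2 fun ω h h' => hJ ?_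
    rw [← (hmem J ω).1 h, ← (hmem J' ω).1 h']
  rw [hset, measure_biUnion_finset hdisj fun J _ => hEm J, Finset.mul_sum]
  refine le_trans ?_ (setLIntegral_le_lintegral (⋃ J ∈ F, E J) _)
  rw [lintegral_biUnion_finset hdisj fun J _ => hEm J]
  refine Finset.sum_le_sum fun J hJ => ?_
  refine (meanCliqueSize_mul_le_setLIntegral hc hφ hp hμ hcφ
    (Finset.mem_filter.1 hJ).2).trans (le_of_eq ?_)
  refine setLIntegral_congr_fun (hEm J) fun ω hω => ?_
  simp only [(hmem J ω).1 hω]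

open Classical in
/-- Chebyshev's inequality for the number of points in a set. -/
lemma measure_le_card_filter_mem {Q : Set X} (hQ : MeasurableSet Q) {m : ℕ} {p : ℝ}
    (hp : μ.real Q = p) (hm : (m : ℝ) < Fintype.card ι * p) :
    1 - Fintype.card ι * p / (Fintype.card ι * p - m) ^ 2 ≤
      (Measure.pi fun _ : ι => μ).real {ω | m ≤ (Finset.univ.filter fun i => ω i ∈ Q).card} := by
  set P : Measure (ι → X) := Measure.pi fun _ : ι => μ with hP
  set q : X → ℝ := Q.indicator 1 with hq
  have hqm : Measurable q := measurable_one.indicator hQ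
  have hqb : ∀ x, |q x| ≤ 1 := fun x => by by_cases h : x ∈ Q <;> simp [hq, h]
  have hqL : MemLp q 2 μ := MemLp.of_bound hqm.aestronglyMeasurable 1
    (ae_of_all _ fun x => by simpa using hqb x)
  set N : (ι → X) → ℝ := ∑ i, fun ω => q (ω i) with hN
  have hNeq : ∀ ω, N ω = (Finset.univ.filter fun i => ω i ∈ Q).card := fun ω => by
    simp [hN, hq, Set.indicator_apply]
  have hNm : Measurable N := by
    have : N = fun ω => ∑ i, q (ω i) := by funext ω; simp [hN]
    rw [this]; exact Finset.measurable_sum _ fun i _ => hqm.comp (measurable_pi_apply i)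
  have hvar : ProbabilityTheory.variance N P ≤ Fintype.card ι * p := by
    rw [hN, hP, ProbabilityTheory.variance_sum_pi fun _ => hqL]
    have : ProbabilityTheory.variance q μ ≤ p := by
      refine (ProbabilityTheory.variance_le_expectation_sq hqm.aestronglyMeasurable).trans_eq ?_
      have : q ^ 2 = Q.indicator 1 := by
        funext x; by_cases h : x ∈ Q <;> simp [hq, h]
      rw [this, integral_indicator_one hQ, hp]
    simpa using mul_le_mul_of_nonneg_left this (Nat.cast_nonneg (Fintype.card ι))
  have hmean : ∫ ω, N ω ∂P = Fintype.card ι * p := by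
    have h1 : ∀ i : ι, ∫ ω, q (ω i) ∂P = p := fun i => by
      have := integral_comp_eval (μ := fun _ : ι => μ) (i := i) (f := q) hqm.aestronglyMeasurable
      rw [hP, this, hq, integral_indicator_one hQ, hp]
    have : ∀ ω, N ω = ∑ i, q (ω i) := fun ω => by simp [hN]
    simp_rw [this]
    rw [integral_finsetSum]
    · simp [h1]
    · exact fun i _ => integrable_of_measurable_of_abs_le (hqm.comp (measurable_pi_apply i))
        fun _ => hqb _
  have hNL : MemLp N 2 P := MemLp.of_bound hNm.aestronglyMeasurable (Fintype.card ι)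
    (ae_of_all _ fun ω => by
      rw [hNeq, Real.norm_eq_abs, Nat.abs_cast]; exact_mod_cast Finset.card_le_univ _)
  have hpos : 0 < Fintype.card ι * p - m := sub_pos.2 hm
  have cheb := ProbabilityTheory.meas_ge_le_variance_div_sq hNL hpos
  have hmeas : MeasurableSet {ω : ι → X | m ≤ (Finset.univ.filter fun i => ω i ∈ Q).card} := by
    have : {ω : ι → X | m ≤ (Finset.univ.filter fun i => ω i ∈ Q).card} = {ω | (m : ℝ) ≤ N ω} := by
      ext ω; simp [hNeq]
    rw [this]; exact measurableSet_le measurable_const hNm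
  have hcompl : P.real {ω : ι → X | m ≤ (Finset.univ.filter fun i => ω i ∈ Q).card}ᶜ
      ≤ Fintype.card ι * p / (Fintype.card ι * p - m) ^ 2 := by
    refine ENNReal.toReal_le_of_le_ofReal (div_nonneg ((Nat.cast_nonneg m).trans hm.le)
      (sq_nonneg _)) ?_
    refine (measure_mono fun ω hω => ?_).trans (cheb.trans (ENNReal.ofReal_le_ofReal ?_))
    · simp only [Set.mem_compl_iff, Set.mem_ofPred_eq, not_le] at hω ⊢
      have : N ω < m := by rw [hNeq]; exact_mod_cast hω
      rw [hmean, abs_sub_comm]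
      exact (by linarith : _ ≤ _).trans (le_abs_self _)
    · exact div_le_div_of_nonneg_right hvar (sq_nonneg _)
  rw [measureReal_compl hmeas, probReal_univ] at hcompl
  linarith

end Blocks

section Cube

variable {r : ℕ}

/-- Distinctness together with comparability for `≼_A`. -/
def chainRel (A : Finpartition (Finset.univ : Finset (Fin r))) (x y : Fin r → ℝ) : Prop :=
  x ≠ y ∧ (leA A x y ∨ leA A y x)

lemma chainLen_eq_cliqueSize (A : Finpartition (Finset.univ : Finset (Fin r))) {n : ℕ}
    (ω : Fin n → Fin r → ℝ) : chainLen A ω = cliqueSize (chainRel A) ω Finset.univ := by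
  classical
  refine IsGreatest.csSup_eq ⟨?_, ?_⟩
  · obtain ⟨K, -, hp, hc⟩ := exists_card_eq_cliqueSize (chainRel A) ω Finset.univ
    refine ⟨K.image ω, ?_, ?_, ?_⟩
    · rw [Finset.coe_image]; exact Set.image_subset_range _ _
    · rw [Finset.coe_image]
      rintro _ ⟨i, hi, rfl⟩ _ ⟨j, hj, rfl⟩ hij
      exact (hp hi hj fun h => hij (h ▸ rfl)).2
    · rw [Finset.card_image_of_injOn, hc]
      intro i hi j hj hij
      by_contra h
      exact (hp hi hj h).1 hij
  · rintro _ ⟨T, hT, hchain, rfl⟩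
    choose f hf using fun t : T => hT t.2
    have hinj : Function.Injective f := fun s t h => Subtype.ext (by rw [← hf s, ← hf t, h])
    have hcard : (Finset.univ.image f).card = T.card := by
      rw [Finset.card_image_of_injective _ hinj]; simp
    rw [← hcard]
    refine card_le_cliqueSize (Finset.subset_univ _) ?_
    rw [Finset.coe_image]
    rintro _ ⟨s, -, rfl⟩ _ ⟨t, -, rfl⟩ hst
    have hne : s.1 ≠ t.1 := fun h => hst (by rw [Subtype.ext h])
    rw [hf, hf]
    exact ⟨hne, hchain s.2 t.2 hne⟩

lemma measurableSet_chainRel (A : Finpartition (Finset.univ : Finset (Fin r))) :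
    MeasurableSet {p : (Fin r → ℝ) × (Fin r → ℝ) | chainRel A p.1 p.2} := by
  have hle : ∀ f g : (Fin r → ℝ) × (Fin r → ℝ) → Fin r → ℝ, Continuous f → Continuous g →
      MeasurableSet {p | leA A (f p) (g p)} := by
    intro f g hf hg
    simp only [leA, Set.ofPred_forall]
    refine (isClosed_iInter fun I => isClosed_iInter fun _ => isClosed_iInter fun i =>
      isClosed_iInter fun _ => isClosed_iInter fun j => isClosed_iInter fun _ => ?_).measurableSet
    exact isClosed_le (by fun_prop) (by fun_prop)
  have hne : MeasurableSet {p : (Fin r → ℝ) × (Fin r → ℝ) | p.1 ≠ p.2} :=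
    (isClosed_eq continuous_fst continuous_snd).measurableSet.compl
  exact hne.inter ((hle _ _ continuous_fst continuous_snd).union
    (hle _ _ continuous_snd continuous_fst))

instance isProbabilityMeasure_restrict_Icc :
    IsProbabilityMeasure (volume.restrict (Set.Icc (0 : ℝ) 1)) := ⟨by simp⟩

instance isProbabilityMeasure_unifCube (r : ℕ) : IsProbabilityMeasure (unifCube r) := by
  unfold unifCube; infer_instance

instance isProbabilityMeasure_pointsMeasure (r n : ℕ) :
    IsProbabilityMeasure (pointsMeasure r n) := by
  unfold pointsMeasure; infer_instance

/-- The `a`-th half-open diagonal block of side `1 / k`. -/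
def diagBlock (r k a : ℕ) : Set (Fin r → ℝ) :=
  Set.univ.pi fun _ => Set.Ico ((a : ℝ) / k) ((a + 1) / k)

/-- The affine map carrying the unit cube to the `a`-th diagonal block. -/
noncomputable def diagMap (r k a : ℕ) (x : Fin r → ℝ) : Fin r → ℝ := fun i => (x i + a) / k

lemma measurable_diagMap (r k a : ℕ) : Measurable (diagMap r k a) := by
  unfold diagMap; fun_prop

lemma measurableSet_diagBlock (r k a : ℕ) : MeasurableSet (diagBlock r k a) :=
  MeasurableSet.univ_pi fun _ => measurableSet_Ico

lemma restrict_Ico_eq_smul_map {k a : ℕ} (hak : a < k) :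
    (volume.restrict (Set.Icc (0 : ℝ) 1)).restrict (Set.Ico ((a : ℝ) / k) ((a + 1) / k))
      = ENNReal.ofReal (1 / k) •
        (volume.restrict (Set.Icc (0 : ℝ) 1)).map fun x : ℝ => (x + a) / k := by
  have hk : (0 : ℝ) < k := by exact_mod_cast (Nat.zero_le a).trans_lt hak
  have hsub : Set.Ico ((a : ℝ) / k) ((a + 1) / k) ⊆ Set.Icc 0 1 := by
    intro x hx
    refine ⟨le_trans (by positivity) hx.1, hx.2.le.trans ?_⟩
    rw [div_le_one hk]; exact_mod_cast hak
  rw [Measure.restrict_restrict measurableSet_Ico, Set.inter_eq_left.2 hsub,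
    Measure.restrict_congr_set Ico_ae_eq_Icc]
  ext s hs
  have hm : Measurable fun x : ℝ => (x + a) / k := by fun_prop
  rw [Measure.smul_apply, Measure.map_apply hm hs, Measure.restrict_apply (hm hs),
    Measure.restrict_apply hs]
  have hpre : (fun x : ℝ => (x + a) / k) ⁻¹' s ∩ Set.Icc 0 1
      = (fun x : ℝ => x + a) ⁻¹' ((fun x : ℝ => x * (k : ℝ)⁻¹) ⁻¹'
          (s ∩ Set.Icc ((a : ℝ) / k) ((a + 1) / k))) := by
    ext x
    simp only [Set.mem_inter_iff, Set.mem_preimage, Set.mem_Icc, ← div_eq_mul_inv]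
    rw [div_le_div_iff_of_pos_right hk, div_le_div_iff_of_pos_right hk]
    refine and_congr_right fun _ => ?_
    constructor <;> rintro ⟨h1, h2⟩ <;> constructor <;> linarith
  rw [hpre, measure_preimage_add_right, Real.volume_preimage_mul_right (by positivity), inv_inv,
    abs_of_pos hk, smul_eq_mul, ← mul_assoc, ← ENNReal.ofReal_mul (by positivity),
    one_div_mul_cancel hk.ne', ENNReal.ofReal_one, one_mul]

lemma unifCube_restrict_diagBlock {k a : ℕ} (hak : a < k) :
    (unifCube r).restrict (diagBlock r k a)
      = ENNReal.ofReal (1 / k) ^ r • (unifCube r).map (diagMap r k a) := by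
  have hm : Measurable fun x : ℝ => (x + a) / k := by fun_prop
  have := Measure.isProbabilityMeasure_map (μ := volume.restrict (Set.Icc (0 : ℝ) 1))
    hm.aemeasurable
  rw [unifCube, diagBlock, Measure.restrict_pi_pi, restrict_Ico_eq_smul_map hak,
    pi_const_smul _ _ ENNReal.ofReal_ne_top, Fintype.card_fin]
  congr 1
  exact (Measure.pi_map_pi fun _ => hm.aemeasurable).symm

lemma unifCube_real_diagBlock {k a : ℕ} (hak : a < k) :
    (unifCube r).real (diagBlock r k a) = (1 / (k : ℝ)) ^ r := by
  have := Measure.isProbabilityMeasure_map (μ := unifCube r)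
    (measurable_diagMap r k a).aemeasurable
  rw [Measure.real, ← Measure.restrict_apply_univ, unifCube_restrict_diagBlock hak]
  simp

lemma chainRel_diagMap (A : Finpartition (Finset.univ : Finset (Fin r))) {k : ℕ} (hk : 0 < k)
    (a : ℕ) {x y : Fin r → ℝ} (h : chainRel A x y) :
    chainRel A (diagMap r k a x) (diagMap r k a y) := by
  have hk' : (0 : ℝ) < k := by exact_mod_cast hk
  have mono : ∀ {x y : Fin r → ℝ}, leA A x y → leA A (diagMap r k a x) (diagMap r k a y) := by
    intro x y h I hI i hi j hj
    have := h I hI i hi j hj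
    unfold diagMap
    gcongr
  refine ⟨fun he => h.1 (funext fun i => ?_), h.2.imp mono mono⟩
  have := congrFun he i
  simp only [diagMap] at this
  rw [div_left_inj' hk'.ne'] at this
  linarith

lemma chainRel_of_mem_diagBlock (A : Finpartition (Finset.univ : Finset (Fin r))) (hr : 1 ≤ r)
    {k a b : ℕ} (hab : a ≠ b) {x y : Fin r → ℝ} (hx : x ∈ diagBlock r k a)
    (hy : y ∈ diagBlock r k b) : chainRel A x y := by
  have lt : ∀ {a b : ℕ} {x y : Fin r → ℝ}, a < b → x ∈ diagBlock r k a → y ∈ diagBlock r k b →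
      ∀ i j, x i < y j := by
    intro a b x y hab hx hy i j
    have h1 := (hx i (Set.mem_univ i)).2
    have h2 := (hy j (Set.mem_univ j)).1
    have : ((a : ℝ) + 1) / k ≤ (b : ℝ) / k := by
      gcongr
      exact_mod_cast hab
    linarith
  rcases lt_or_gt_of_ne hab with h | h
  · exact ⟨fun he => (lt h hx hy ⟨0, hr⟩ ⟨0, hr⟩).ne (by rw [he]),
      Or.inl fun I _ i _ j _ => (lt h hx hy i j).le⟩
  · exact ⟨fun he => (lt h hy hx ⟨0, hr⟩ ⟨0, hr⟩).ne (by rw [he]),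
      Or.inr fun I _ i _ j _ => (lt h hy hx i j).le⟩

/-- The mean length of the longest chain among `n` uniform points. -/
noncomputable def meanChainLen (A : Finpartition (Finset.univ : Finset (Fin r))) (n : ℕ) : ℝ :=
  ∫ ω, (chainLen A ω : ℝ) ∂(pointsMeasure r n)

lemma measurable_chainLen (A : Finpartition (Finset.univ : Finset (Fin r))) (n : ℕ) :
    Measurable fun ω : Fin n → Fin r → ℝ => (chainLen A ω : ℝ) := by
  simp_rw [chainLen_eq_cliqueSize]
  exact (measurable_of_countable _).comp (measurable_cliqueSize (measurableSet_chainRel A) _)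

lemma chainLen_le (A : Finpartition (Finset.univ : Finset (Fin r))) {n : ℕ}
    (ω : Fin n → Fin r → ℝ) : chainLen A ω ≤ n := by
  rw [chainLen_eq_cliqueSize]
  simpa using cliqueSize_le_card (chainRel A) ω Finset.univ

lemma integrable_chainLen (A : Finpartition (Finset.univ : Finset (Fin r))) (n : ℕ) :
    Integrable (fun ω : Fin n → Fin r → ℝ => (chainLen A ω : ℝ)) (pointsMeasure r n) :=
  integrable_of_measurable_of_abs_le (measurable_chainLen A n) (C := n) fun ω => by
    rw [Nat.abs_cast]; exact_mod_cast chainLen_le A ω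

lemma ofReal_meanChainLen (A : Finpartition (Finset.univ : Finset (Fin r))) (n : ℕ) :
    ENNReal.ofReal (meanChainLen A n) = meanCliqueSize (unifCube r) (chainRel A) n := by
  rw [meanChainLen, ofReal_integral_eq_lintegral_ofReal (integrable_chainLen A n)
    (ae_of_all _ fun _ => Nat.cast_nonneg _)]
  simp_rw [ENNReal.ofReal_natCast, chainLen_eq_cliqueSize]
  rfl

lemma meanChainLen_nonneg (A : Finpartition (Finset.univ : Finset (Fin r))) (n : ℕ) :
    0 ≤ meanChainLen A n := integral_nonneg fun _ => Nat.cast_nonneg _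

lemma one_le_meanChainLen (A : Finpartition (Finset.univ : Finset (Fin r))) {n : ℕ} (hn : 1 ≤ n) :
    1 ≤ meanChainLen A n := by
  have h : ∫ _ : Fin n → Fin r → ℝ, (1 : ℝ) ∂(pointsMeasure r n) ≤ meanChainLen A n := by
    refine integral_mono (integrable_const _) (integrable_chainLen A n) fun ω => ?_
    have : ({⟨0, hn⟩} : Finset (Fin n)).card ≤ cliqueSize (chainRel A) ω Finset.univ :=
      card_le_cliqueSize (Finset.subset_univ _) (by simp)
    rw [Finset.card_singleton, ← chainLen_eq_cliqueSize] at this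
    exact Nat.one_le_cast.2 this
  simpa using h

/-- Superadditivity along the diagonal. -/
lemma mul_meanChainLen_le (A : Finpartition (Finset.univ : Finset (Fin r))) (hr : 1 ≤ r)
    {k m n : ℕ} (hk : 0 < k) (hm : (m : ℝ) < n * (1 / k) ^ r) :
    k * (meanChainLen A m * (1 - n * (1 / k) ^ r / (n * (1 / k) ^ r - m) ^ 2))
      ≤ meanChainLen A n := by
  classical
  set s : ℝ := 1 - n * (1 / k) ^ r / (n * (1 / k) ^ r - m) ^ 2 with hs
  rw [← ENNReal.ofReal_le_ofReal_iff (meanChainLen_nonneg A n), ENNReal.ofReal_mul (by positivity),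
    ENNReal.ofReal_mul (meanChainLen_nonneg A m), ofReal_meanChainLen, ofReal_meanChainLen,
    ENNReal.ofReal_natCast]
  have hblock : ∀ a : Fin k, meanCliqueSize (unifCube r) (chainRel A) m * ENNReal.ofReal s
      ≤ ∫⁻ ω, (cliqueSize (chainRel A) ω
          (Finset.univ.filter fun i => ω i ∈ diagBlock r k a) : ENNReal)
          ∂(Measure.pi fun _ : Fin n => unifCube r) := by
    intro a
    refine le_trans ?_ (meanCliqueSize_mul_measure_le (measurableSet_chainRel A)
      (measurableSet_diagBlock r k a) (measurable_diagMap r k a)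
      (ENNReal.pow_ne_top ENNReal.ofReal_ne_top) (unifCube_restrict_diagBlock a.2)
      (fun _ _ => chainRel_diagMap A hk a) m)
    gcongr
    refine ENNReal.ofReal_le_of_le_toReal ?_
    have := measure_le_card_filter_mem (ι := Fin n) (measurableSet_diagBlock r k a) (m := m)
      (unifCube_real_diagBlock a.2) (by simpa using hm)
    simpa [hs, Measure.real] using this
  calc (k : ENNReal) * (meanCliqueSize (unifCube r) (chainRel A) m * ENNReal.ofReal s)
      = ∑ _a : Fin k, meanCliqueSize (unifCube r) (chainRel A) m * ENNReal.ofReal s := by simp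
    _ ≤ ∑ a : Fin k, ∫⁻ ω, (cliqueSize (chainRel A) ω
          (Finset.univ.filter fun i => ω i ∈ diagBlock r k a) : ENNReal)
          ∂(Measure.pi fun _ : Fin n => unifCube r) := Finset.sum_le_sum fun a _ => hblock a
    _ ≤ ∫⁻ ω, ∑ a : Fin k, (cliqueSize (chainRel A) ω
          (Finset.univ.filter fun i => ω i ∈ diagBlock r k a) : ENNReal)
          ∂(Measure.pi fun _ : Fin n => unifCube r) := by
        induction (Finset.univ : Finset (Fin k)) using Finset.induction_on with
        | empty => simp
        | insert a t ha ih =>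
          simp only [Finset.sum_insert ha]
          exact (add_le_add_right ih _).trans (le_lintegral_add _ _)
    _ ≤ meanCliqueSize (unifCube r) (chainRel A) n := by
        refine lintegral_mono fun ω => ?_
        have hrel : ∀ a b : Fin k, a ≠ b →
            ∀ i ∈ Finset.univ.filter (fun i => ω i ∈ diagBlock r k a),
            ∀ j ∈ Finset.univ.filter (fun i => ω i ∈ diagBlock r k b),
            chainRel A (ω i) (ω j) := fun a b hab i hi j hj =>
          chainRel_of_mem_diagBlock A hr (fun h => hab (Fin.ext h)) (Finset.mem_filter.1 hi).2
            (Finset.mem_filter.1 hj).2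
        have := sum_cliqueSize_le (c := chainRel A) ω
          (fun a : Fin k => Finset.univ.filter fun i => ω i ∈ diagBlock r k a)
          (fun a b hab => Finset.disjoint_left.2 fun i hi hj => (hrel a b hab i hi i hj).1 rfl)
          (fun a b hab => hrel a b hab)
        rw [← Nat.cast_sum]
        exact Nat.cast_le.2 this

/-- The variance of the longest chain length is at most its mean. -/
lemma integral_sq_sub_sq_meanChainLen_le (A : Finpartition (Finset.univ : Finset (Fin r)))
    (n : ℕ) :
    ∫ ω, (chainLen A ω : ℝ) ^ 2 ∂(pointsMeasure r n) - meanChainLen A n ^ 2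
      ≤ meanChainLen A n := by
  classical
  have hb : ∀ (ω : Fin n → Fin r → ℝ) J, |(cliqueSize (chainRel A) ω J : ℝ)| ≤ n := fun ω J => by
    rw [Nat.abs_cast]
    exact_mod_cast (cliqueSize_le_card _ ω J).trans (by simpa using Finset.card_le_univ J)
  have hmeas : ∀ J : Finset (Fin n), Measurable fun ω : Fin n → Fin r → ℝ =>
      (cliqueSize (chainRel A) ω J : ℝ) := fun J =>
    (measurable_of_countable _).comp (measurable_cliqueSize (measurableSet_chainRel A) _)
  have hES := efron_stein (unifCube r) n (fun ω => (cliqueSize (chainRel A) ω Finset.univ : ℝ))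
    (hmeas _) n (fun ω => hb ω _)
    (fun i ω => (cliqueSize (chainRel A) ω (Finset.univ.erase i) : ℝ)) (fun i => hmeas _)
    (fun i ω => hb ω _) fun i ω ω' h => by
      rw [cliqueSize_congr fun j hj => h j (Finset.ne_of_mem_erase hj)]
  rw [← integral_finsetSum] at hES
  · simp_rw [meanChainLen, chainLen_eq_cliqueSize]
    refine hES.trans (integral_mono_of_nonneg (ae_of_all _ fun ω => ?_) ?_ (ae_of_all _ fun ω =>
      sum_sq_cliqueSize_sub_erase_le (chainRel A) ω))
    · exact Finset.sum_nonneg fun i _ => sq_nonneg _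
    · exact integrable_of_measurable_of_abs_le (hmeas _) fun ω => hb ω _
  · intro i _
    refine integrable_of_measurable_of_abs_le (((hmeas _).sub (hmeas _)).pow_const 2)
      (C := (n + n) ^ 2) fun ω => ?_
    rw [abs_pow]
    exact pow_le_pow_left₀ (abs_nonneg _) ((abs_sub _ _).trans (add_le_add (hb ω _) (hb ω _))) 2

end Cube

section UpperBound

variable {r : ℕ}

lemma setIntegral_indicator_Ici_pow_le (k : ℕ) (t : ℝ) :
    ∫ x in Set.Icc (0 : ℝ) 1, (Set.Ici t).indicator (fun x => max 0 (1 - x) ^ k / k.factorial) x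
      ≤ max 0 (1 - t) ^ (k + 1) / (k + 1).factorial := by
  rw [setIntegral_indicator measurableSet_Ici]
  have hint : IntegrableOn (fun x : ℝ => max 0 (1 - x) ^ k / k.factorial) (Set.Icc t 1) :=
    ContinuousOn.integrableOn_Icc (by fun_prop)
  have hnn : ∀ x : ℝ, 0 ≤ max 0 (1 - x) ^ k / k.factorial := fun x => by positivity
  refine (setIntegral_mono_set hint (ae_of_all _ hnn)
    (LE.le.eventuallyLE fun x hx => ⟨hx.2, hx.1.2⟩)).trans ?_
  rcases le_or_gt t 1 with ht | ht
  · rw [integral_Icc_eq_integral_Ioc, ← intervalIntegral.integral_of_le ht]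
    have h1 : ∫ x in t..1, max 0 (1 - x) ^ k / (k.factorial : ℝ)
        = ∫ x in t..1, (1 - x) ^ k / (k.factorial : ℝ) := by
      refine intervalIntegral.integral_congr fun x hx => ?_
      rw [Set.uIcc_of_le ht] at hx
      simp only [max_eq_right (sub_nonneg.2 hx.2)]
    rw [h1, intervalIntegral.integral_comp_sub_left (fun y => y ^ k / (k.factorial : ℝ)),
      intervalIntegral.integral_div, integral_pow, max_eq_right (sub_nonneg.2 ht), div_div,
      Nat.factorial_succ]
    push_cast
    simp
  · rw [Set.Icc_eq_empty (not_le.2 ht)]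
    simp only [Measure.restrict_empty, integral_zero_measure]
    positivity

lemma lintegral_prod_indicator_Ici_le (k : ℕ) (t : Fin r → ℝ) :
    ∫⁻ x, (Set.Ici t).indicator
        (fun x => ENNReal.ofReal (∏ c, max 0 (1 - x c) ^ k / k.factorial)) x ∂(unifCube r)
      ≤ ENNReal.ofReal (∏ c, max 0 (1 - t c) ^ (k + 1) / (k + 1).factorial) := by
  set f : Fin r → ℝ → ℝ := fun c =>
    (Set.Ici (t c)).indicator (fun x => max 0 (1 - x) ^ k / k.factorial) with hf
  have hf0 : ∀ c y, 0 ≤ f c y := fun c y =>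
    Set.indicator_nonneg (fun x _ => by positivity) y
  have hfi : ∀ c, Integrable (f c) (volume.restrict (Set.Icc (0 : ℝ) 1)) := fun c =>
    Integrable.indicator (ContinuousOn.integrableOn_Icc (by fun_prop)) measurableSet_Ici
  have heq : ∀ x : Fin r → ℝ, (Set.Ici t).indicator
      (fun x => ENNReal.ofReal (∏ c, max 0 (1 - x c) ^ k / k.factorial)) x
      ≤ ENNReal.ofReal (∏ c, f c (x c)) := by
    intro x
    by_cases hx : x ∈ Set.Ici t
    · rw [Set.indicator_of_mem hx]
      refine ENNReal.ofReal_le_ofReal (Finset.prod_le_prod (fun c _ => by positivity)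
        fun c _ => ?_)
      rw [hf]
      simp only
      rw [Set.indicator_of_mem (show x c ∈ Set.Ici (t c) from hx c)]
    · rw [Set.indicator_of_notMem hx]
      exact zero_le
  refine (lintegral_mono heq).trans ?_
  rw [unifCube, ← ofReal_integral_eq_lintegral_ofReal (Integrable.fintype_prod hfi)
    (ae_of_all _ fun x => Finset.prod_nonneg fun c _ => hf0 c _),
    integral_fintype_prod_eq_prod]
  exact ENNReal.ofReal_le_ofReal (Finset.prod_le_prod
    (fun c _ => integral_nonneg (hf0 c)) fun c _ => setIntegral_indicator_Ici_pow_le k (t c))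

lemma measurableSet_monotone_ge (k : ℕ) (t : Fin r → ℝ) :
    MeasurableSet {ω : Fin k → Fin r → ℝ | Monotone ω ∧ ∀ i, t ≤ ω i} := by
  have h1 : IsClosed {ω : Fin k → Fin r → ℝ | Monotone ω} := isClosed_monotone
  have h2 : IsClosed {ω : Fin k → Fin r → ℝ | ∀ i, t ≤ ω i} := by
    rw [Set.ofPred_forall]
    exact isClosed_iInter fun i => isClosed_le (by fun_prop) (by fun_prop)
  exact (h1.inter h2).measurableSet

/-- The probability that `k` uniform points form an increasing sequence above `t`. -/
lemma pointsMeasure_monotone_ge_le (k : ℕ) (t : Fin r → ℝ) :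
    pointsMeasure r k {ω | Monotone ω ∧ ∀ i, t ≤ ω i}
      ≤ ENNReal.ofReal (∏ c, max 0 (1 - t c) ^ k / k.factorial) := by
  induction k generalizing t with
  | zero => simpa using prob_le_one
  | succ k ih =>
    have mp := (measurePreserving_piFinSuccAbove (fun _ : Fin (k + 1) => unifCube r) 0).symm
    have hm := measurableSet_monotone_ge (k + 1) t
    rw [pointsMeasure, ← mp.measure_preimage hm.nullMeasurableSet,
      Measure.prod_apply (mp.measurable hm)]
    refine le_trans (lintegral_mono fun x => ?_) (lintegral_prod_indicator_Ici_le k t)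
    by_cases hx : x ∈ Set.Ici t
    · rw [Set.indicator_of_mem hx]
      refine le_trans (measure_mono ?_) (ih x)
      rintro ω ⟨hω, -⟩
      have hω' : Monotone (Fin.cons x ω : Fin (k + 1) → Fin r → ℝ) := by
        rw [← Fin.insertNth_zero']
        exact hω
      refine ⟨fun i j hij => ?_, fun i => ?_⟩
      · simpa using hω' (Fin.succ_le_succ_iff.2 hij)
      · simpa using hω' (Fin.zero_le i.succ)
    · rw [Set.indicator_of_notMem hx, nonpos_iff_eq_zero, ← measure_empty (μ := pointsMeasure r k)]
      congr 1
      refine Set.eq_empty_of_forall_notMem fun ω hω => hx ?_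
      simpa using hω.2 0

lemma measurableSet_monotone (k : ℕ) :
    MeasurableSet {ω : Fin k → Fin r → ℝ | Monotone ω} :=
  (isClosed_monotone (α := Fin r → ℝ) (β := Fin k)).measurableSet

lemma pointsMeasure_monotone_le (k : ℕ) :
    pointsMeasure r k {ω | Monotone ω} ≤ ENNReal.ofReal ((1 / k.factorial) ^ r) := by
  have hae : ∀ᵐ ω ∂(pointsMeasure r k), ∀ i, (0 : Fin r → ℝ) ≤ ω i := by
    rw [ae_all_iff]
    intro i
    have h0 : ∀ᵐ x ∂(unifCube r), (0 : Fin r → ℝ) ≤ x := by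
      have : ∀ c : Fin r, ∀ᵐ x ∂(unifCube r), 0 ≤ x c := fun c =>
        (measurePreserving_eval (fun _ : Fin r => volume.restrict (Set.Icc (0 : ℝ) 1))
          c).quasiMeasurePreserving.ae
          ((ae_restrict_mem measurableSet_Icc).mono fun y hy => hy.1)
      filter_upwards [ae_all_iff.2 this] with x hx
      exact hx
    exact (measurePreserving_eval (fun _ : Fin k => unifCube r) i).quasiMeasurePreserving.ae h0
  refine (measure_mono_ae ?_).trans ((pointsMeasure_monotone_ge_le k (0 : Fin r → ℝ)).trans ?_)
  · filter_upwards [hae] with ω h hω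
    exact ⟨hω, h⟩
  · simp

lemma le_of_leA {A : Finpartition (Finset.univ : Finset (Fin r))} {x y : Fin r → ℝ}
    (h : leA A x y) : x ≤ y := fun i => by
  obtain ⟨I, hI, hi⟩ := A.exists_mem (Finset.mem_univ i)
  exact h I hI i hi i hi

lemma exists_monotone_of_le_chainLen {A : Finpartition (Finset.univ : Finset (Fin r))} {k n : ℕ}
    {ω : Fin n → Fin r → ℝ} (h : k ≤ chainLen A ω) :
    ∃ e : Fin k ↪ Fin n, Monotone fun i => ω (e i) := by
  rw [chainLen_eq_cliqueSize] at h
  obtain ⟨K, -, hK, hc⟩ := exists_card_eq_cliqueSize (chainRel A) ω Finset.univ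
  obtain ⟨K', hK', rfl⟩ := Finset.exists_subset_card_eq (h.trans hc.ge)
  set f : Fin K'.card ↪ Fin n := (K'.orderEmbOfFin rfl).toEmbedding with hf
  have hmem : ∀ i, f i ∈ K := fun i => hK' (Finset.orderEmbOfFin_mem K' rfl i)
  set g : Fin K'.card → ℝ := fun i => ∑ c, ω (f i) c with hg
  refine ⟨(Tuple.sort g).toEmbedding.trans f, fun i j hij => ?_⟩
  rcases hij.eq_or_lt with rfl | hlt
  · exact le_rfl
  have hsum : g (Tuple.sort g i) ≤ g (Tuple.sort g j) := Tuple.monotone_sort g hij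
  have hne : f (Tuple.sort g i) ≠ f (Tuple.sort g j) := fun he =>
    hlt.ne ((Tuple.sort g).injective (f.injective he))
  rcases (hK (hmem _) (hmem _) hne).2 with hle | hle
  · exact le_of_leA hle
  · have hle' := le_of_leA hle
    have heq := (Finset.sum_eq_sum_iff_of_le fun c _ => hle' c).1
      (le_antisymm (Finset.sum_le_sum fun c _ => hle' c) hsum)
    exact fun c => (heq c (Finset.mem_univ c)).ge

lemma pointsMeasure_le_chainLen_le (A : Finpartition (Finset.univ : Finset (Fin r))) (k n : ℕ) :
    (pointsMeasure r n).real {ω | k ≤ chainLen A ω} ≤ (n : ℝ) ^ k * (1 / k.factorial) ^ r := by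
  have hsub : {ω : Fin n → Fin r → ℝ | k ≤ chainLen A ω}
      ⊆ ⋃ e : Fin k ↪ Fin n, (fun ω i => ω (e i)) ⁻¹' {ω | Monotone ω} := fun ω hω =>
    Set.mem_iUnion.2 (exists_monotone_of_le_chainLen hω)
  have hone : ∀ e : Fin k ↪ Fin n, pointsMeasure r n
      ((fun ω i => ω (e i)) ⁻¹' {ω | Monotone ω}) ≤ ENNReal.ofReal ((1 / k.factorial) ^ r) := by
    intro e
    rw [← Measure.map_apply (by fun_prop) (measurableSet_monotone k), pointsMeasure,
      map_pi_comp_of_injective _ e.injective]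
    exact pointsMeasure_monotone_le k
  refine ENNReal.toReal_le_of_le_ofReal (by positivity) ?_
  calc pointsMeasure r n {ω | k ≤ chainLen A ω}
      ≤ ∑ e : Fin k ↪ Fin n, pointsMeasure r n ((fun ω i => ω (e i)) ⁻¹' {ω | Monotone ω}) :=
        (measure_mono hsub).trans (measure_iUnion_fintype_le _ _)
    _ ≤ ∑ _e : Fin k ↪ Fin n, ENNReal.ofReal ((1 / k.factorial) ^ r) :=
        Finset.sum_le_sum fun e _ => hone e
    _ ≤ ENNReal.ofReal ((n : ℝ) ^ k * (1 / k.factorial) ^ r) := by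
        rw [Finset.sum_const, Finset.card_univ, Fintype.card_embedding_eq, nsmul_eq_mul,
          ENNReal.ofReal_mul (by positivity), ← Nat.cast_pow, ENNReal.ofReal_natCast]
        gcongr
        simpa using Nat.descFactorial_le_pow n k

lemma pow_mul_one_div_factorial_pow_le (hr : 1 ≤ r) {k n : ℕ}
    (hk : 2 * Real.exp 1 * (n : ℝ) ^ ((1 : ℝ) / r) ≤ k) :
    (n : ℝ) ^ k * (1 / k.factorial) ^ r ≤ (1 / 2) ^ k := by
  have hr0 : (r : ℝ) ≠ 0 := by exact_mod_cast (by omega : r ≠ 0)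
  set x : ℝ := (n : ℝ) ^ ((1 : ℝ) / r) with hx
  have hx0 : 0 ≤ x := by positivity
  have hxr : x ^ r = n := by
    rw [hx, ← Real.rpow_natCast, ← Real.rpow_mul (Nat.cast_nonneg n), one_div_mul_cancel hr0,
      Real.rpow_one]
  have hfac : (2 * x) ^ k ≤ k.factorial := by
    have h1 := Real.pow_div_factorial_le_exp (k : ℝ) (Nat.cast_nonneg k) k
    rw [div_le_iff₀ (by positivity)] at h1
    have h2 : (Real.exp 1 * (2 * x)) ^ k ≤ (k : ℝ) ^ k := by
      gcongr
      linarith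
    rw [mul_pow, ← Real.exp_nat_mul, mul_one] at h2
    exact le_of_mul_le_mul_left (h2.trans h1) (Real.exp_pos _)
  have h3 : (2 : ℝ) ^ k * n ^ k ≤ (k.factorial : ℝ) ^ r := by
    calc (2 : ℝ) ^ k * n ^ k ≤ (2 ^ r) ^ k * (x ^ r) ^ k := by
          rw [hxr]
          gcongr
          exact le_self_pow₀ one_le_two (by omega)
      _ = ((2 * x) ^ k) ^ r := by rw [← mul_pow, ← mul_pow, pow_right_comm]
      _ ≤ (k.factorial : ℝ) ^ r := by gcongr
  rw [one_div_pow, one_div_pow, mul_one_div, div_le_div_iff₀ (by positivity) (by positivity)]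
  linarith

/-- The mean longest chain grows at most like `n ^ (1 / r)`. -/
lemma meanChainLen_le (A : Finpartition (Finset.univ : Finset (Fin r))) (hr : 1 ≤ r) {n : ℕ}
    (hn : 1 ≤ n) :
    meanChainLen A n ≤ (2 * Real.exp 1 + 3) * (n : ℝ) ^ ((1 : ℝ) / r) := by
  set x : ℝ := (n : ℝ) ^ ((1 : ℝ) / r) with hx
  have hx1 : 1 ≤ x := Real.one_le_rpow (by exact_mod_cast hn) (by positivity)
  set k₀ := ⌈2 * Real.exp 1 * x⌉₊ with hk₀
  have hk₀' : (k₀ : ℝ) < 2 * Real.exp 1 * x + 1 := Nat.ceil_lt_add_one (by positivity)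
  have hset : ∀ k, MeasurableSet {ω : Fin n → Fin r → ℝ | k ≤ chainLen A ω} := fun k => by
    have := measurableSet_le (measurable_const (a := (k : ℝ))) (measurable_chainLen A n)
    simpa using this
  set F : (Fin n → Fin r → ℝ) → ℝ := fun ω =>
    k₀ + ∑ k ∈ Finset.Icc k₀ n, {ω | k ≤ chainLen A ω}.indicator 1 ω with hF
  have hpt : ∀ ω, (chainLen A ω : ℝ) ≤ F ω := by
    intro ω
    have h1 : ∑ k ∈ Finset.Icc k₀ n, {ω | k ≤ chainLen A ω}.indicator (1 : (Fin n → Fin r → ℝ) → ℝ) ω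
        = ((Finset.Icc k₀ n).filter fun k => k ≤ chainLen A ω).card := by
      simp [Set.indicator_apply, Finset.sum_boole]
    have h2 : Finset.Icc k₀ (chainLen A ω)
        ⊆ (Finset.Icc k₀ n).filter fun k => k ≤ chainLen A ω := fun k hk => by
      have := chainLen_le A ω
      simp only [Finset.mem_filter, Finset.mem_Icc] at hk ⊢
      omega
    have h3 := Finset.card_le_card h2
    rw [Nat.card_Icc] at h3
    rw [hF]
    simp only
    rw [h1]
    exact_mod_cast (by omega : chainLen A ω ≤ k₀ + _)
  have hint : ∀ k, Integrable ({ω : Fin n → Fin r → ℝ | k ≤ chainLen A ω}.indicator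
      (1 : (Fin n → Fin r → ℝ) → ℝ)) (pointsMeasure r n) := fun k =>
    (integrable_const (1 : ℝ)).indicator (hset k)
  calc meanChainLen A n ≤ ∫ ω, F ω ∂(pointsMeasure r n) :=
        integral_mono (integrable_chainLen A n)
          ((integrable_const _).add (integrable_finsetSum _ fun k _ => hint k)) hpt
    _ = k₀ + ∑ k ∈ Finset.Icc k₀ n, (pointsMeasure r n).real {ω | k ≤ chainLen A ω} := by
        rw [hF, integral_add (integrable_const _) (integrable_finsetSum _ fun k _ => hint k),
          integral_finsetSum _ fun k _ => hint k]
        simp [integral_indicator_one (hset _)]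
    _ ≤ k₀ + ∑ k ∈ Finset.Icc k₀ n, (1 / 2 : ℝ) ^ k := by
        gcongr with k hk
        refine (pointsMeasure_le_chainLen_le A k n).trans
          (pow_mul_one_div_factorial_pow_le hr ((Nat.le_ceil _).trans ?_))
        exact_mod_cast (Finset.mem_Icc.1 hk).1
    _ ≤ k₀ + 2 := by
        gcongr
        exact (summable_geometric_two.sum_le_tsum _ fun k _ => by positivity).trans_eq
          tsum_geometric_two
    _ ≤ (2 * Real.exp 1 + 3) * x := by linarith

end UpperBound

section Limit

open Filter Topology

lemma div_sub_sq_le {x m δ : ℝ} (hm : 0 < m) (hδ : 0 < δ) (hx : (1 + δ) * m ≤ x) :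
    x / (x - m) ^ 2 ≤ (1 + δ) / (δ ^ 2 * m) := by
  have hxm : 0 < x - m := by nlinarith
  have hx0 : 0 < x := by linarith
  have h1 : δ * x ≤ (1 + δ) * (x - m) := by nlinarith
  rw [div_le_div_iff₀ (by positivity) (by positivity)]
  have h2 : (δ * x) ^ 2 ≤ ((1 + δ) * (x - m)) ^ 2 := by gcongr
  have h3 : (1 + δ) * m * (δ ^ 2 * x) ≤ x * (δ ^ 2 * x) := by gcongr
  have h4 : (1 + δ) * (x * (δ ^ 2 * m)) ≤ (1 + δ) * ((1 + δ) * (x - m) ^ 2) := by nlinarith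
  exact le_of_mul_le_mul_left h4 (by linarith)

variable {r : ℕ} {M : ℕ → ℝ}

/-- The lower bound for the normalised sequence at large `n` given by its value at `m`. -/
lemma mul_div_rpow_le_liminf (hr : 1 ≤ r) (h0 : ∀ n, 0 ≤ M n)
    (hsup : ∀ k m n : ℕ, 0 < k → (m : ℝ) < n * (1 / k) ^ r →
      k * (M m * (1 - n * (1 / k) ^ r / (n * (1 / k) ^ r - m) ^ 2)) ≤ M n)
    (hbdd : IsBoundedUnder (· ≤ ·) atTop fun n : ℕ => M n / (n : ℝ) ^ ((1 : ℝ) / r))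
    {m : ℕ} (hm : 1 ≤ m) {δ : ℝ} (hδ : 0 < δ) :
    M m / (m : ℝ) ^ ((1 : ℝ) / r) * (1 - (1 + δ) / (δ ^ 2 * m)) / (1 + δ) ^ ((1 : ℝ) / r)
      ≤ liminf (fun n : ℕ => M n / (n : ℝ) ^ ((1 : ℝ) / r)) atTop := by
  have hr0 : (r : ℝ) ≠ 0 := by exact_mod_cast (by omega : r ≠ 0)
  have hm0 : (0 : ℝ) < m := by exact_mod_cast hm
  set q : ℝ := (1 : ℝ) / r with hq
  have hq0 : 0 < q := by positivity
  set s : ℝ := 1 - (1 + δ) / (δ ^ 2 * m) with hs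
  set y : ℕ → ℝ := fun n => ((n : ℝ) / ((1 + δ) * m)) ^ q with hy
  have hytop : Tendsto y atTop atTop :=
    (tendsto_rpow_atTop hq0).comp
      (tendsto_natCast_atTop_atTop.atTop_div_const (by positivity))
  set v : ℕ → ℝ := fun n => (⌊y n⌋₊ : ℝ) / y n * (M m * s / ((1 + δ) * m) ^ q) with hv
  have hvlim : Tendsto v atTop (𝓝 (M m / (m : ℝ) ^ q * s / (1 + δ) ^ q)) := by
    have h1 : Tendsto (fun n => (⌊y n⌋₊ : ℝ) / y n) atTop (𝓝 1) :=
      (tendsto_nat_floor_div_atTop (R := ℝ)).comp hytop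
    convert h1.mul_const (M m * s / ((1 + δ) * m) ^ q) using 2
    rw [Real.mul_rpow (by positivity) hm0.le]
    field_simp
  have hle : ∀ᶠ n in atTop, v n ≤ M n / (n : ℝ) ^ q := by
    filter_upwards [hytop.eventually_ge_atTop 1, eventually_ge_atTop 1] with n hyn hn
    have hn0 : (0 : ℝ) < n := by exact_mod_cast hn
    have hk : 0 < ⌊y n⌋₊ := Nat.floor_pos.2 hyn
    set k := ⌊y n⌋₊ with hk_def
    have hk0 : (0 : ℝ) < k := by exact_mod_cast hk
    have hky : (k : ℝ) ≤ y n := Nat.floor_le (by linarith)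
    have hkr : (k : ℝ) ^ r ≤ n / ((1 + δ) * m) := by
      calc (k : ℝ) ^ r ≤ y n ^ r := by gcongr
        _ = n / ((1 + δ) * m) := by
          rw [hy, ← Real.rpow_natCast, ← Real.rpow_mul (by positivity), hq,
            one_div_mul_cancel hr0, Real.rpow_one]
    have hx : (1 + δ) * m ≤ n * (1 / (k : ℝ)) ^ r := by
      rw [le_div_iff₀ (by positivity)] at hkr
      rw [one_div_pow, mul_one_div, le_div_iff₀ (by positivity)]
      linarith
    have hbound := hsup k m n hk (by nlinarith)
    have hks : k * (M m * s) ≤ M n := by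
      refine le_trans ?_ hbound
      have := div_sub_sq_le hm0 hδ hx
      have := h0 m
      rw [hs]
      gcongr
    have hyn' : y n * ((1 + δ) * m) ^ q = (n : ℝ) ^ q := by
      rw [hy, ← Real.mul_rpow (by positivity) (by positivity), div_mul_cancel₀ _ (by positivity)]
    have hy0 : 0 < y n := by linarith
    calc v n = k * (M m * s) / (n : ℝ) ^ q := by
          rw [hv, ← hyn']
          simp only [← hk_def]
          field_simp
      _ ≤ M n / (n : ℝ) ^ q := by gcongr
  rw [← hvlim.liminf_eq]
  exact liminf_le_liminf hle hvlim.isBoundedUnder_ge hbdd.isCoboundedUnder_ge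

lemma exists_tendsto_div_rpow (hr : 1 ≤ r) {C : ℝ} (h0 : ∀ n, 0 ≤ M n)
    (h1 : ∀ n, 1 ≤ n → 1 ≤ M n) (hC : ∀ n, 1 ≤ n → M n ≤ C * (n : ℝ) ^ ((1 : ℝ) / r))
    (hsup : ∀ k m n : ℕ, 0 < k → (m : ℝ) < n * (1 / k) ^ r →
      k * (M m * (1 - n * (1 / k) ^ r / (n * (1 / k) ^ r - m) ^ 2)) ≤ M n) :
    ∃ a : ℝ, 0 < a ∧ Tendsto (fun n : ℕ => M n / (n : ℝ) ^ ((1 : ℝ) / r)) atTop (𝓝 a) := by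
  set q : ℝ := (1 : ℝ) / r with hq
  set u : ℕ → ℝ := fun n => M n / (n : ℝ) ^ q with hu
  have hbdd : IsBoundedUnder (· ≤ ·) atTop u := by
    refine isBoundedUnder_of_eventually_le (a := C) ?_
    filter_upwards [eventually_ge_atTop 1] with n hn
    have hn0 : (0 : ℝ) < n := by exact_mod_cast hn
    rw [hu]
    simp only
    rw [div_le_iff₀ (by positivity)]
    exact hC n hn
  have hbdd' : IsBoundedUnder (· ≥ ·) atTop u :=
    isBoundedUnder_of_eventually_ge (a := 0) (Eventually.of_forall fun n =>
      div_nonneg (h0 n) (by positivity))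
  have key := fun (m : ℕ) (hm : 1 ≤ m) (δ : ℝ) (hδ : 0 < δ) =>
    mul_div_rpow_le_liminf hr h0 hsup hbdd hm hδ
  set l := liminf u atTop with hl
  refine ⟨l, ?_, ?_⟩
  · have := key 3 (by norm_num) 1 one_pos
    refine lt_of_lt_of_le ?_ this
    have h3 := h1 3 (by norm_num)
    have : (0 : ℝ) < 1 - (1 + 1) / (1 ^ 2 * (3 : ℕ)) := by norm_num
    positivity
  · have hδ : ∀ δ : ℝ, 0 < δ → limsup u atTop ≤ l * (1 + δ) ^ q := by
      intro δ hδ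
      have hs : Tendsto (fun m : ℕ => 1 - (1 + δ) / (δ ^ 2 * (m : ℝ))) atTop (𝓝 1) := by
        have : Tendsto (fun m : ℕ => (1 + δ) / (δ ^ 2 * (m : ℝ))) atTop (𝓝 0) :=
          tendsto_const_nhds.div_atTop
            (tendsto_natCast_atTop_atTop.const_mul_atTop (by positivity))
        simpa using this.const_sub 1
      have hw : Tendsto (fun m : ℕ => l * (1 + δ) ^ q / (1 - (1 + δ) / (δ ^ 2 * (m : ℝ)))) atTop
          (𝓝 (l * (1 + δ) ^ q)) := by
        have := (tendsto_const_nhds (x := l * (1 + δ) ^ q)).div hs one_ne_zero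
        rwa [div_one] at this
      rw [← hw.limsup_eq]
      refine limsup_le_limsup ?_ hbdd'.isCoboundedUnder_le hw.isBoundedUnder_le
      filter_upwards [eventually_ge_atTop 1, hs.eventually_const_lt one_pos] with m hm hsm
      have := key m hm δ hδ
      rw [div_le_iff₀ (by positivity)] at this
      rwa [le_div_iff₀ hsm]
    have hlim : Tendsto (fun δ : ℝ => l * (1 + δ) ^ q) (𝓝[>] 0) (𝓝 l) := by
      have : Tendsto (fun δ : ℝ => l * (1 + δ) ^ q) (𝓝 0) (𝓝 (l * (1 + 0) ^ q)) := by
        refine ((tendsto_const_nhds.add tendsto_id).rpow_const (Or.inl ?_)).const_mul l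
        norm_num
      simpa using this.mono_left nhdsWithin_le_nhds
    exact tendsto_of_le_liminf_of_limsup_le le_rfl
      (ge_of_tendsto hlim (eventually_nhdsWithin_of_forall hδ)) hbdd hbdd'

end Limit

section Concentration

variable {r : ℕ}

lemma measure_le_abs_chainLen_sub_le (A : Finpartition (Finset.univ : Finset (Fin r))) (n : ℕ)
    {t : ℝ} (ht : 0 < t) :
    pointsMeasure r n {ω | t ≤ |(chainLen A ω : ℝ) - meanChainLen A n|}
      ≤ ENNReal.ofReal (meanChainLen A n / t ^ 2) := by
  have hmem : MemLp (fun ω : Fin n → Fin r → ℝ => (chainLen A ω : ℝ)) 2 (pointsMeasure r n) :=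
    MemLp.of_bound (measurable_chainLen A n).aestronglyMeasurable n (ae_of_all _ fun ω => by
      simpa using chainLen_le A ω)
  refine (ProbabilityTheory.meas_ge_le_variance_div_sq hmem ht).trans ?_
  refine ENNReal.ofReal_le_ofReal ?_
  gcongr
  rw [ProbabilityTheory.variance_eq_sub hmem]
  exact integral_sq_sub_sq_meanChainLen_le A n

end Concentration

/-- **Theorem 5.3.** Fix `r ≥ 1` and a partition `A` of `{1,…,r}`, and let
`L = L_A(S_n)` where `S_n` is a set of `n` independent uniformly random points
in `[0,1]^r`. Then there is a constant `a_A > 0` such that `L/n^(1/r)`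
converges in probability to `a_A` and `E[L]/n^(1/r)` converges to `a_A`. -/
theorem random_points_chain_limit (r : ℕ) (hr : 1 ≤ r)
    (A : Finpartition (Finset.univ : Finset (Fin r))) :
    ∃ a : ℝ, 0 < a ∧
      (∀ ε : ℝ, 0 < ε →
        Filter.Tendsto
          (fun n : ℕ => pointsMeasure r n
            {ω | ε ≤ |(chainLen A ω : ℝ) / (n : ℝ) ^ ((1 : ℝ) / (r : ℝ)) - a|})
          Filter.atTop (nhds 0)) ∧
      Filter.Tendsto
        (fun n : ℕ => (∫ ω, (chainLen A ω : ℝ) ∂(pointsMeasure r n))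
          / (n : ℝ) ^ ((1 : ℝ) / (r : ℝ)))
        Filter.atTop (nhds a) := by
  obtain ⟨a, ha, hlim⟩ := exists_tendsto_div_rpow hr (meanChainLen_nonneg A)
    (fun _ => one_le_meanChainLen A) (fun _ => meanChainLen_le A hr)
    fun _ _ _ hk hm => mul_meanChainLen_le A hr hk hm
  refine ⟨a, ha, fun ε hε => ?_, hlim⟩
  set x : ℕ → ℝ := fun n => (n : ℝ) ^ ((1 : ℝ) / (r : ℝ)) with hx
  have hr0 : (0 : ℝ) < r := by exact_mod_cast hr
  have hxtop : Filter.Tendsto x Filter.atTop Filter.atTop :=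
    (tendsto_rpow_atTop (by positivity)).comp tendsto_natCast_atTop_atTop
  have hzero : Filter.Tendsto
      (fun n => ENNReal.ofReal (meanChainLen A n / x n / (ε / 2) ^ 2 / x n))
      Filter.atTop (nhds 0) := by
    rw [← ENNReal.ofReal_zero]
    exact ENNReal.tendsto_ofReal ((hlim.div_const _).div_atTop hxtop)
  refine tendsto_of_tendsto_of_tendsto_of_le_of_le' tendsto_const_nhds hzero
    (Filter.Eventually.of_forall fun _ => zero_le) ?_
  filter_upwards [hxtop.eventually_gt_atTop 0,
    Metric.tendsto_nhds.1 hlim (ε / 2) (by positivity)] with n hxn hn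
  refine (measure_mono fun ω hω => ?_).trans
    ((measure_le_abs_chainLen_sub_le A n (t := ε / 2 * x n) (by positivity)).trans_eq ?_)
  · have hω' : ε ≤ |(chainLen A ω : ℝ) / x n - a| := hω
    have h1 := abs_sub_le ((chainLen A ω : ℝ) / x n) (meanChainLen A n / x n) a
    rw [Real.dist_eq] at hn
    change ε / 2 * x n ≤ |(chainLen A ω : ℝ) - meanChainLen A n|
    rw [← le_div_iff₀ hxn, ← abs_of_pos hxn, ← abs_div, sub_div]
    linarith
  · congr 1
    field_simp
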